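/- Let V be a type and for m ∈ V define the delete-and-repair map ψ_m on relations A ⊆ V × V by ψ_m(A) := {(i,k) : i ≠ m, k ≠ m, and either (i,k) ∈ A, or both (i,m) ∈ A and (m,k) ∈ A}. Then for any two distinct elements m, m' ∈ V and any relation A ⊆ V × V, ψ_m(ψ_{m'}(A)) = ψ_{m'}(ψ_m(A)). -/

import Mathlib

/-- The delete-and-repair map for vertex `m` on a directed graph (relation) `A` on `V`:
delete `m` and add an edge `i → k` whenever the directed path `i → m → k` existed. -/
def deleteRepair {V : Type*} (m : V) (A : Set (V × V)) : Set (V × V) :=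
  {p | p.1 ≠ m ∧ p.2 ≠ m ∧ (p ∈ A ∨ ((p.1, m) ∈ A ∧ (m, p.2) ∈ A))}

/-- Delete-and-repair maps at distinct vertices commute:
`ψ_m (ψ_{m'} (A)) = ψ_{m'} (ψ_m (A))`. -/
theorem deleteRepair_comm {V : Type*} (m m' : V) (hmm : m ≠ m') (A : Set (V × V)) :
    deleteRepair m (deleteRepair m' A) = deleteRepair m' (deleteRepair m A) := by
  ext ⟨i, k⟩
  simp only [deleteRepair, Set.mem_ofPred_eq]
  have hmm' := hmm.symm
  tauto
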